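/- Let A be any set-linearizable implementation of the set-concurrent queue with multiplicity. Then every execution of A in which all Deq operations return pairwise distinct values is linearizable with respect to the sequential queue. -/

import Mathlib

/-- Operations of a queue over items in ℕ. -/
inductive QueueOp
  | enq (x : ℕ)
  | deq
  deriving DecidableEq

/-- Possible outputs: `ok` (= true, for enqueue), an item, or empty (ε). -/
inductive QueueRes
  | ok
  | val (x : ℕ)
  | empty
  deriving DecidableEq

/-- A concurrent history (execution at the interface level): `m` operations, each
with its kind, its invocation time, and, if it is completed, its response time and
its output (`none` in both fields means the operation is pending). -/
structure ConcHistory (Op Res : Type) where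
  m : ℕ
  op : Fin m → Op
  inv : Fin m → ℕ
  ret : Fin m → Option ℕ
  out : Fin m → Option Res

/-- `op i` precedes `op j`: the response of `i` occurs before the invocation of `j`. -/
def ConcHistory.precedes {Op Res : Type} (h : ConcHistory Op Res) (i j : Fin h.m) : Prop :=
  ∃ t, h.ret i = some t ∧ t < h.inv j

/-- Two operations are concurrent if they are incomparable w.r.t. `precedes`. -/
def ConcHistory.concurrent {Op Res : Type} (h : ConcHistory Op Res) (i j : Fin h.m) : Prop :=
  ¬ h.precedes i j ∧ ¬ h.precedes j i

/-- Transition of the set-concurrent queue with multiplicity taken by a concurrency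
class `C` of operations (given by their indices in a history): either a single
enqueue (appending at the tail), or between 1 and `n` concurrent dequeues all
returning the head item, or a single dequeue returning empty on the empty queue. -/
def queueClassDelta (n : ℕ) {m : ℕ} (op : Fin m → QueueOp) (out : Fin m → QueueRes)
    (q : List ℕ) (C : Finset (Fin m)) (q' : List ℕ) : Prop :=
  (∃ i x, C = {i} ∧ op i = QueueOp.enq x ∧ out i = QueueRes.ok ∧ q' = q ++ [x]) ∨
  (∃ x, q = x :: q' ∧ 1 ≤ C.card ∧ C.card ≤ n ∧
      ∀ i ∈ C, op i = QueueOp.deq ∧ out i = QueueRes.val x) ∨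
  (∃ i, C = {i} ∧ op i = QueueOp.deq ∧ out i = QueueRes.empty ∧ q = [] ∧ q' = [])

/-- A set-linearization of a history `h` w.r.t. the set-concurrent queue with
multiplicity (`n` processes): operations are assigned to `K` linearly ordered
concurrency classes (every completed operation is assigned, pending ones may be),
outputs agree with those of `h` on completed operations, consecutive classes are
related by the transition relation starting from the empty queue, and the
real-time order of `h` is respected. -/
structure SetLinearization (n : ℕ) (h : ConcHistory QueueOp QueueRes) where
  K : ℕ
  cls : Fin h.m → Option (Fin K)
  lout : Fin h.m → QueueRes
  states : Fin (K + 1) → List ℕ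
  complete_assigned : ∀ i, (h.out i).isSome → (cls i).isSome
  out_agree : ∀ i r, h.out i = some r → lout i = r
  init : states 0 = []
  classes_nonempty : ∀ k : Fin K, ∃ i, cls i = some k
  step : ∀ k : Fin K,
    queueClassDelta n h.op lout (states k.castSucc)
      (Finset.univ.filter (fun i => cls i = some k)) (states k.succ)
  order : ∀ i j ki kj, h.precedes i j → cls i = some ki → cls j = some kj →
    (ki : ℕ) < (kj : ℕ)

/-- A history is set-linearizable w.r.t. the set-concurrent queue with multiplicity. -/
def SetLinearizable (n : ℕ) (h : ConcHistory QueueOp QueueRes) : Prop :=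
  Nonempty (SetLinearization n h)

/-- Transition of the sequential queue. -/
def SeqQueueDelta (q : List ℕ) (p : QueueOp × QueueRes) (q' : List ℕ) : Prop :=
  (∃ x, p = (QueueOp.enq x, QueueRes.ok) ∧ q' = q ++ [x]) ∨
  (∃ x, q = x :: q' ∧ p = (QueueOp.deq, QueueRes.val x)) ∨
  (q = [] ∧ q' = [] ∧ p = (QueueOp.deq, QueueRes.empty))

/-- A sequential execution of the sequential queue. -/
inductive SeqQueueExec : List ℕ → List (QueueOp × QueueRes) → List ℕ → Prop
  | nil (q : List ℕ) : SeqQueueExec q [] q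
  | cons {q q' q'' : List ℕ} {p : QueueOp × QueueRes} {ps : List (QueueOp × QueueRes)} :
      SeqQueueDelta q p q' → SeqQueueExec q' ps q'' → SeqQueueExec q (p :: ps) q''

/-- A linearization of a history `h` w.r.t. the sequential queue: a sequence of
(distinct) operations of `h` containing all completed ones, whose outputs agree
with `h`, respecting the real-time order of `h`, and forming a sequential execution
of the queue from the empty initial state. -/
structure Linearization (h : ConcHistory QueueOp QueueRes) where
  seq : List (Fin h.m)
  lout : Fin h.m → QueueRes
  nodup : seq.Nodup
  complete_mem : ∀ i, (h.out i).isSome → i ∈ seq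
  out_agree : ∀ i r, h.out i = some r → lout i = r
  order : ∀ k1 k2 : Fin seq.length,
    h.precedes (seq.get k1) (seq.get k2) → (k1 : ℕ) < (k2 : ℕ)
  valid : ∃ qf, SeqQueueExec [] (seq.map (fun i => (h.op i, lout i))) qf

/-- A history is linearizable w.r.t. the sequential queue. -/
def Linearizable (h : ConcHistory QueueOp QueueRes) : Prop :=
  Nonempty (Linearization h)

theorem SeqQueueExec.ofFn {K : ℕ} (states : Fin (K + 1) → List ℕ)
    (p : Fin K → QueueOp × QueueRes)
    (hstep : ∀ k : Fin K, SeqQueueDelta (states k.castSucc) (p k) (states k.succ)) :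
    SeqQueueExec (states 0) (List.ofFn p) (states (Fin.last K)) := by
  induction K with
  | zero => simpa using SeqQueueExec.nil (states 0)
  | succ K ih =>
    rw [List.ofFn_succ]
    exact SeqQueueExec.cons (hstep 0)
      (ih (fun k => states k.succ) (fun k => p k.succ) (fun k => hstep k.succ))

/-- Any member of a concurrency class can take the transition of the class alone. -/
theorem queueClassDelta.seqQueueDelta {n m : ℕ} {op : Fin m → QueueOp} {out : Fin m → QueueRes}
    {q q' : List ℕ} {C : Finset (Fin m)} (hC : queueClassDelta n op out q C q')
    {i : Fin m} (hi : i ∈ C) : SeqQueueDelta q (op i, out i) q' := by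
  rcases hC with ⟨j, x, rfl, hop, hout, hq⟩ | ⟨x, hq, -, -, hall⟩ | ⟨j, rfl, hop, hout, hq, hq'⟩
  · obtain rfl := Finset.mem_singleton.mp hi
    exact Or.inl ⟨x, by rw [hop, hout], hq⟩
  · exact Or.inr (Or.inl ⟨x, hq, by rw [(hall i hi).1, (hall i hi).2]⟩)
  · obtain rfl := Finset.mem_singleton.mp hi
    exact Or.inr (Or.inr ⟨hq, hq', by rw [hop, hout]⟩)

/-- If no value is returned by two completed operations, then every concurrency class has a
member that is the only one that may be completed. -/
theorem SetLinearization.exists_representative {n : ℕ} {h : ConcHistory QueueOp QueueRes}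
    (L : SetLinearization n h)
    (hdistinct : ∀ (i j : Fin h.m) (x : ℕ),
      h.out i = some (QueueRes.val x) → h.out j = some (QueueRes.val x) → i = j)
    (k : Fin L.K) :
    ∃ i, L.cls i = some k ∧ ∀ j, L.cls j = some k → (h.out j).isSome → j = i := by
  by_cases hex : ∃ i, L.cls i = some k ∧ (h.out i).isSome
  · obtain ⟨i, hi, hci⟩ := hex
    refine ⟨i, hi, fun j hj hcj => ?_⟩
    obtain ⟨r, hr⟩ := Option.isSome_iff_exists.mp hci
    obtain ⟨s, hs⟩ := Option.isSome_iff_exists.mp hcj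
    have hi' : i ∈ Finset.univ.filter (fun i => L.cls i = some k) := by simpa using hi
    have hj' : j ∈ Finset.univ.filter (fun i => L.cls i = some k) := by simpa using hj
    rcases L.step k with ⟨l, x, hC, -⟩ | ⟨x, -, -, -, hall⟩ | ⟨l, hC, -⟩
    · rw [hC, Finset.mem_singleton] at hi' hj'
      rw [hi', hj']
    · have hrx := (L.out_agree i r hr).symm.trans (hall i hi').2
      have hsx := (L.out_agree j s hs).symm.trans (hall j hj').2
      exact hdistinct j i x (hsx ▸ hs) (hrx ▸ hr)
    · rw [hC, Finset.mem_singleton] at hi' hj'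
      rw [hi', hj']
  · obtain ⟨i, hi⟩ := L.classes_nonempty k
    exact ⟨i, hi, fun j hj hcj => absurd ⟨j, hj, hcj⟩ hex⟩

/-- Let `A` be any set-linearizable implementation (identified with its set of
histories) of the set-concurrent queue with multiplicity, where every item is
enqueued at most once.  Then every execution of `A` in which all Deq operations
return pairwise distinct values is linearizable with respect to the sequential
queue. -/
theorem setLinearizableQueue_distinctDeqValues_linearizable
    (n : ℕ) (A : Set (ConcHistory QueueOp QueueRes))
    (hA : ∀ h ∈ A, SetLinearizable n h)
    (h : ConcHistory QueueOp QueueRes) (hmem : h ∈ A)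
    (henqUnique : ∀ (i j : Fin h.m) (x : ℕ),
      h.op i = QueueOp.enq x → h.op j = QueueOp.enq x → i = j)
    (hdistinct : ∀ (i j : Fin h.m) (x : ℕ),
      h.out i = some (QueueRes.val x) → h.out j = some (QueueRes.val x) → i = j) :
    Linearizable h := by
  obtain ⟨L⟩ := hA h hmem
  choose rep hcls huniq using L.exists_representative hdistinct
  refine ⟨⟨List.ofFn rep, L.lout, ?_, ?_, L.out_agree, ?_, ?_⟩⟩
  · refine List.nodup_ofFn.mpr fun k l hkl => ?_
    exact Option.some.inj ((hcls k).symm.trans ((congrArg L.cls hkl).trans (hcls l)))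
  · intro i hi
    obtain ⟨k, hk⟩ := Option.isSome_iff_exists.mp (L.complete_assigned i hi)
    exact List.mem_ofFn.mpr ⟨k, (huniq k i hk hi).symm⟩
  · intro k₁ k₂ hprec
    rw [List.get_ofFn, List.get_ofFn] at hprec
    exact L.order _ _ _ _ hprec (hcls _) (hcls _)
  · refine ⟨L.states (Fin.last L.K), ?_⟩
    rw [List.map_ofFn, ← L.init]
    exact SeqQueueExec.ofFn L.states _ fun k =>
      (L.step k).seqQueueDelta (Finset.mem_filter.mpr ⟨Finset.mem_univ _, hcls k⟩)
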